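/- Let n, p ≥ 1, let A_1, …, A_p be real symmetric n×n matrices, and let C be a real number such that Σ_{β=1}^{p} ‖A_β v‖² ≤ C ‖v‖² for every vector v ∈ ℝⁿ. Then for each fixed index α, Σ_{β=1}^{p} N([A_α, A_β]) ≤ 4 C · trace(A_α²) − 4 trace(A_α⁴), where [A,B] = AB − BA and N(C) = trace(Cᵀ C) denotes the squared Frobenius norm. -/

import Mathlib

open Matrix BigOperators

theorem Matrix.trace_transpose_mul_self_eq_sum {m n : Type*} [Fintype m] [Fintype n]
    (M : Matrix m n ℝ) : trace (Mᵀ * M) = ∑ j, ∑ i, M i j ^ 2 := by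
  simp [trace, mul_apply, sq]

theorem Matrix.trace_transpose_mul_self_nonneg {m n : Type*} [Fintype m] [Fintype n]
    (M : Matrix m n ℝ) : 0 ≤ trace (Mᵀ * M) := by
  rw [trace_transpose_mul_self_eq_sum]
  positivity

/-- The parallelogram identity for the Frobenius norms of the commutator and the anticommutator
of two symmetric matrices. -/
theorem Matrix.IsSymm.trace_commutator_add_trace_anticommutator {n : Type*} [Fintype n]
    {A B : Matrix n n ℝ} (hA : A.IsSymm) (hB : B.IsSymm) :
    trace ((A * B - B * A)ᵀ * (A * B - B * A)) + trace ((A * B + B * A)ᵀ * (A * B + B * A)) =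
      4 * trace ((B * A)ᵀ * (B * A)) := by
  have h : trace (B * A * (A * B)) = trace (A * B * (B * A)) := trace_mul_comm _ _
  simp only [transpose_sub, transpose_add, transpose_mul, hA.eq, hB.eq, sub_mul, mul_sub, add_mul,
    mul_add, trace_sub, trace_add]
  linarith

theorem Matrix.sum_trace_transpose_mul_self_le_of_opBound {ι m n k : Type*} [Fintype ι]
    [Fintype m] [Fintype n] [Fintype k] (A : ι → Matrix m n ℝ) (C : ℝ)
    (hC : ∀ v : n → ℝ, ∑ β, ∑ i, ((A β).mulVec v i) ^ 2 ≤ C * ∑ i, (v i) ^ 2)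
    (M : Matrix n k ℝ) :
    ∑ β, trace ((A β * M)ᵀ * (A β * M)) ≤ C * trace (Mᵀ * M) := by
  simp only [trace_transpose_mul_self_eq_sum]
  rw [Finset.sum_comm, Finset.mul_sum]
  exact Finset.sum_le_sum fun j _ => hC fun i => M i j

/-- Let `A_1, …, A_p` be real symmetric `n × n` matrices and `C : ℝ` with
`∑_β ‖A_β v‖² ≤ C ‖v‖²` for every `v : ℝⁿ`.  Then for each fixed index `α`,
`∑_β N([A_α, A_β]) ≤ 4 C trace(A_α²) − 4 trace(A_α⁴)`, where `[A,B] = A*B − B*A`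
and `N(C) = trace (Cᵀ * C)` is the squared Frobenius norm. -/
theorem sum_commutator_norm_le_of_opBound {n p : ℕ} (hn : 1 ≤ n) (hp : 1 ≤ p)
    (A : Fin p → Matrix (Fin n) (Fin n) ℝ) (hA : ∀ β, (A β).IsSymm) (C : ℝ)
    (hC : ∀ v : Fin n → ℝ, ∑ β, ∑ i, ((A β).mulVec v i) ^ 2 ≤ C * ∑ i, (v i) ^ 2)
    (α : Fin p) :
    ∑ β, Matrix.trace ((A α * A β - A β * A α)ᵀ * (A α * A β - A β * A α)) ≤
      4 * C * Matrix.trace ((A α) ^ 2) - 4 * Matrix.trace ((A α) ^ 4) := by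
  have hsum := Finset.sum_congr rfl fun β (_ : β ∈ Finset.univ) =>
    (hA α).trace_commutator_add_trace_anticommutator (hA β)
  rw [Finset.sum_add_distrib, ← Finset.mul_sum] at hsum
  have hbound := sum_trace_transpose_mul_self_le_of_opBound A C hC (A α)
  have hsingle := Finset.single_le_sum
    (f := fun β => trace ((A α * A β + A β * A α)ᵀ * (A α * A β + A β * A α)))
    (fun β _ => trace_transpose_mul_self_nonneg _) (Finset.mem_univ α)
  have hsq : trace ((A α)ᵀ * A α) = trace (A α ^ 2) := by rw [(hA α).eq, sq]
  have hfour : trace ((A α * A α + A α * A α)ᵀ * (A α * A α + A α * A α)) =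
      4 * trace (A α ^ 4) := by
    have h : A α ^ 4 = A α * A α * (A α * A α) := by noncomm_ring
    simp only [transpose_add, transpose_mul, (hA α).eq, add_mul, mul_add, trace_add, h]
    ring
  rw [hsq] at hbound
  simp only [hfour] at hsingle
  linarith
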